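/- arXiv:2410.23565 — 6 statements merged into one kernel-verified Lean document; each statement's English description precedes it below -/
import Mathlib

section
/- Let (X,k₁) and (Y,k₂) be digital images with X ⊆ ℤ^{n₁}, Y ⊆ ℤ^{n₂}, k₁ = k(t₁,n₁), k₂ = k(t₂,n₂), and identify X×Y with a subset of ℤ^{n₁+n₂} by concatenating coordinates. For a k = k(t, n₁+n₂)-adjacency on X×Y, the following are equivalent: (1) the k-adjacency is a normal k-adjacency on X×Y derived from (X,k₁) and (Y,k₂); (2) for every point p = (x,y) ∈ X×Y, N_k(p) = N_{k₁}(x) × N_{k₂}(y). -/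
/-- `k(t,·)`-adjacency of points of `ℤ^ι`. -/
def kAdj {ι : Type*} [Fintype ι] (t : ℕ) (p q : ι → ℤ) : Prop :=
  p ≠ q ∧ (∀ i, |p i - q i| ≤ 1) ∧
    (Finset.univ.filter (fun i => p i ≠ q i)).card ≤ t

/-- The digital `k`-neighborhood of `x₀` in a digital image `X`. -/
def nbhd {ι : Type*} [Fintype ι] (X : Set (ι → ℤ)) (t : ℕ) (x₀ : ι → ℤ) :
    Set (ι → ℤ) :=
  {x ∈ X | kAdj t x x₀} ∪ {x₀}

/-- The `k(t,n₁+n₂)`-adjacency is a *normal* `k`-adjacency on `X × Y` (coordinates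
concatenated) derived from `(X,k(t₁,n₁))` and `(Y,k(t₂,n₂))`. -/
def IsNormalAdj {n₁ n₂ : ℕ} (X : Set (Fin n₁ → ℤ)) (Y : Set (Fin n₂ → ℤ))
    (t₁ t₂ t : ℕ) : Prop :=
  ∀ x ∈ X, ∀ y ∈ Y, ∀ x' ∈ X, ∀ y' ∈ Y,
    (kAdj t (Fin.append x y) (Fin.append x' y') ↔
      ((y = y' ∧ kAdj t₁ x x') ∨ (x = x' ∧ kAdj t₂ y y') ∨
        (kAdj t₁ x x' ∧ kAdj t₂ y y')))

theorem kAdj_comm {ι : Type*} [Fintype ι] {t : ℕ} {p q : ι → ℤ} :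
    kAdj t p q ↔ kAdj t q p := by
  simp only [kAdj, ne_comm, abs_sub_comm]

theorem not_kAdj_self {ι : Type*} [Fintype ι] {t : ℕ} {p : ι → ℤ} : ¬ kAdj t p p :=
  fun h => h.1 rfl

theorem mem_nbhd_iff {ι : Type*} [Fintype ι] {X : Set (ι → ℤ)} {t : ℕ} {x x₀ : ι → ℤ}
    (hx₀ : x₀ ∈ X) : x ∈ nbhd X t x₀ ↔ x ∈ X ∧ (kAdj t x₀ x ∨ x₀ = x) := by
  rw [kAdj_comm, eq_comm (a := x₀)]
  constructor
  · rintro (⟨hx, h⟩ | rfl)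
    exacts [⟨hx, .inl h⟩, ⟨hx₀, .inr rfl⟩]
  · rintro ⟨hx, h | rfl⟩
    exacts [.inl ⟨hx, h⟩, .inr rfl]

theorem Fin.append_inj_iff {m n : ℕ} {α : Type*} {x x' : Fin m → α} {y y' : Fin n → α} :
    Fin.append x y = Fin.append x' y' ↔ x = x' ∧ y = y' := by
  refine ⟨fun h => ⟨funext fun i => ?_, funext fun i => ?_⟩, by rintro ⟨rfl, rfl⟩; rfl⟩
  · simpa using congrFun h (Fin.castAdd n i)
  · simpa using congrFun h (Fin.natAdd m i)

theorem append_mem_image2_iff {m n : ℕ} {α : Type*} {A : Set (Fin m → α)}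
    {B : Set (Fin n → α)} {x : Fin m → α} {y : Fin n → α} :
    Fin.append x y ∈ Set.image2 Fin.append A B ↔ x ∈ A ∧ y ∈ B := by
  refine ⟨?_, fun h => Set.mem_image2_of_mem h.1 h.2⟩
  rintro ⟨a, ha, b, hb, h⟩
  obtain ⟨rfl, rfl⟩ := Fin.append_inj_iff.1 h
  exact ⟨ha, hb⟩

theorem nbhd_image2_append_eq_iff {n₁ n₂ t₁ t₂ t : ℕ} {X : Set (Fin n₁ → ℤ)}
    {Y : Set (Fin n₂ → ℤ)} {x : Fin n₁ → ℤ} {y : Fin n₂ → ℤ} (hx : x ∈ X) (hy : y ∈ Y) :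
    nbhd (Set.image2 Fin.append X Y) t (Fin.append x y) =
        Set.image2 Fin.append (nbhd X t₁ x) (nbhd Y t₂ y) ↔
      ∀ x' ∈ X, ∀ y' ∈ Y,
        (kAdj t (Fin.append x y) (Fin.append x' y') ∨ (x = x' ∧ y = y') ↔
          (kAdj t₁ x x' ∨ x = x') ∧ (kAdj t₂ y y' ∨ y = y')) := by
  have hxy := Set.mem_image2_of_mem (f := Fin.append) hx hy
  constructor
  · intro h x' hx' y' hy'
    have := Set.ext_iff.1 h (Fin.append x' y')
    simpa [mem_nbhd_iff, hx, hy, hx', hy', hxy, append_mem_image2_iff, Fin.append_inj_iff]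
      using this
  · intro h
    ext p
    constructor
    · intro hp
      obtain ⟨⟨x', hx', y', hy', rfl⟩, hp⟩ := (mem_nbhd_iff hxy).1 hp
      rw [Fin.append_inj_iff, h x' hx' y' hy'] at hp
      exact Set.mem_image2_of_mem ((mem_nbhd_iff hx).2 ⟨hx', hp.1⟩)
        ((mem_nbhd_iff hy).2 ⟨hy', hp.2⟩)
    · rintro ⟨x', hx', y', hy', rfl⟩
      obtain ⟨hx', hxx⟩ := (mem_nbhd_iff hx).1 hx'
      obtain ⟨hy', hyy⟩ := (mem_nbhd_iff hy).1 hy'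
      rw [mem_nbhd_iff hxy, Fin.append_inj_iff, h x' hx' y' hy']
      exact ⟨Set.mem_image2_of_mem hx' hy', hxx, hyy⟩

theorem normal_iff_nbhd_prod (n₁ n₂ t₁ t₂ t : ℕ)
    (ht₁ : 1 ≤ t₁) (ht₁n : t₁ ≤ n₁) (ht₂ : 1 ≤ t₂) (ht₂n : t₂ ≤ n₂)
    (ht : 1 ≤ t) (htn : t ≤ n₁ + n₂)
    (X : Set (Fin n₁ → ℤ)) (Y : Set (Fin n₂ → ℤ)) :
    IsNormalAdj X Y t₁ t₂ t ↔
      (∀ x ∈ X, ∀ y ∈ Y,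
        nbhd (Set.image2 Fin.append X Y) t (Fin.append x y) =
          Set.image2 Fin.append (nbhd X t₁ x) (nbhd Y t₂ y)) := by
  refine forall₄_congr fun x hx y hy => ?_
  rw [nbhd_image2_append_eq_iff hx hy]
  refine forall₄_congr fun x' _ y' _ => ?_
  have h₁ : x = x' → ¬ kAdj t₁ x x' := by rintro rfl; exact not_kAdj_self
  have h₂ : y = y' → ¬ kAdj t₂ y y' := by rintro rfl; exact not_kAdj_self
  have h : x = x' ∧ y = y' → ¬ kAdj t (Fin.append x y) (Fin.append x' y') := by
    rintro ⟨rfl, rfl⟩; exact not_kAdj_self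
  tauto
end

section
/- Let MSC₁₈ = {x₀=(0,0,0), x₁=(1,−1,0), x₂=(1,−1,1), x₃=(2,0,1), x₄=(1,1,1), x₅=(1,1,0)} ⊆ ℤ³ with the 18-adjacency (k(2,3)-adjacency), and identify MSC₁₈ × MSC₁₈ with a subset of ℤ⁶. Then for no t with 1 ≤ t ≤ 6 (i.e., for no k ∈ {12, 72, 232, 472, 664, 728}) is the k(t,6)-adjacency on MSC₁₈ × MSC₁₈ a C-compatible k-adjacency derived from (MSC₁₈,18) and (MSC₁₈,18), and for no such t is it a normal k-adjacency derived from (MSC₁₈,18) and (MSC₁₈,18). -/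
/-- The `k(t,n₁+n₂)`-adjacency is a *C-compatible* `k`-adjacency on `X × Y`. -/
def IsCCompatibleAdj {n₁ n₂ : ℕ} (X : Set (Fin n₁ → ℤ)) (Y : Set (Fin n₂ → ℤ))
    (t₁ t₂ t : ℕ) : Prop :=
  ∀ x ∈ X, ∀ y ∈ Y, ∀ x' ∈ X, ∀ y' ∈ Y,
    (kAdj t (Fin.append x y) (Fin.append x' y') ↔
      ((y = y' ∧ kAdj t₁ x x') ∨ (x = x' ∧ kAdj t₂ y y')))

/-- `MSC₁₈ ⊆ ℤ³`. -/
def MSC18 : Set (Fin 3 → ℤ) :=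
  {![0, 0, 0], ![1, -1, 0], ![1, -1, 1], ![2, 0, 1], ![1, 1, 1], ![1, 1, 0]}

instance {ι : Type*} [Fintype ι] [DecidableEq ι] (t : ℕ) (p q : ι → ℤ) :
    Decidable (kAdj t p q) :=
  decidable_of_iff (p ≠ q ∧ (∀ i, |p i - q i| ≤ 1) ∧
    (Finset.univ.filter (fun i => p i ≠ q i)).card ≤ t) Iff.rfl

theorem kAdj.mono {ι : Type*} [Fintype ι] {s t : ℕ} {p q : ι → ℤ} (h : kAdj s p q)
    (hst : s ≤ t) : kAdj t p q :=
  ⟨h.1, h.2.1, h.2.2.trans hst⟩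

/-- No `k(t,6)`-adjacency on `MSC₁₈ × MSC₁₈ ⊆ ℤ⁶` is a C-compatible `k`-adjacency or a
normal `k`-adjacency derived from `(MSC₁₈, 18)` and `(MSC₁₈, 18)`. -/
theorem msc18_prod_no_cCompatible_no_normal :
    ∀ t : ℕ, 1 ≤ t → t ≤ 6 →
      ¬ IsCCompatibleAdj MSC18 MSC18 2 2 t ∧ ¬ IsNormalAdj MSC18 MSC18 2 2 t := by
  intro t _ _
  have h0 : ![0, 0, 0] ∈ MSC18 := by simp [MSC18]
  have h1 : ![1, -1, 0] ∈ MSC18 := by simp [MSC18]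
  have h2 : ![1, -1, 1] ∈ MSC18 := by simp [MSC18]
  constructor
  · intro h
    rcases Nat.lt_or_ge t 2 with ht | ht
    · have hadj := (h _ h0 _ h0 _ h1 _ h0).2 (Or.inl ⟨rfl, by decide⟩)
      exact absurd (hadj.mono (Nat.le_of_lt_succ ht)) (by decide)
    · have hadj : kAdj 2 (Fin.append ![1, -1, 0] ![1, -1, 0])
          (Fin.append ![1, -1, 1] ![1, -1, 1]) := by decide
      exact absurd ((h _ h1 _ h1 _ h2 _ h2).1 (hadj.mono ht)) (by decide)
  · intro h
    rcases Nat.lt_or_ge t 4 with ht | ht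
    · have hadj := (h _ h0 _ h0 _ h1 _ h1).2 (Or.inr (Or.inr ⟨by decide, by decide⟩))
      exact absurd (hadj.mono (Nat.le_of_lt_succ ht)) (by decide)
    · have hadj : kAdj 4 (Fin.append ![0, 0, 0] ![0, 0, 0])
          (Fin.append ![1, -1, 1] ![0, 0, 0]) := by decide
      exact absurd ((h _ h0 _ h0 _ h2 _ h0).1 (hadj.mono ht)) (by decide)
end

section
/- Let X₁ ⊆ ℤ^{n₁} and X₂ ⊆ ℤ^{n₂} be any nonempty subsets, equipped with the 2n₁-adjacency (k(1,n₁)-adjacency) and the 2n₂-adjacency (k(1,n₂)-adjacency) respectively. Then the k(1, n₁+n₂)-adjacency (i.e., the 2(n₁+n₂)-adjacency) on X₁ × X₂ ⊆ ℤ^{n₁+n₂} is always a C-compatible k-adjacency derived from (X₁,2n₁) and (X₂,2n₂): for all p = (x₁,x₂), q = (x₁′,x₂′) ∈ X₁×X₂, p and q are k(1,n₁+n₂)-adjacent if and only if (x₂ = x₂′ and x₁,x₁′ are k(1,n₁)-adjacent) or (x₁ = x₁′ and x₂,x₂′ are k(1,n₂)-adjacent). -/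
theorem hammingDist_append {α : Type*} [DecidableEq α] {m n : ℕ} (x x' : Fin m → α)
    (y y' : Fin n → α) :
    hammingDist (Fin.append x y) (Fin.append x' y') = hammingDist x x' + hammingDist y y' := by
  simp only [hammingDist, Finset.card_filter, Fin.sum_univ_add, Fin.append_left, Fin.append_right]

theorem kAdj_iff_hammingDist {ι : Type*} [Fintype ι] {t : ℕ} {p q : ι → ℤ} :
    kAdj t p q ↔ 0 < hammingDist p q ∧ (∀ i, |p i - q i| ≤ 1) ∧ hammingDist p q ≤ t := by
  rw [hammingDist_pos]
  rfl

theorem forall_abs_append_sub_le_iff {m n : ℕ} (x x' : Fin m → ℤ) (y y' : Fin n → ℤ) (c : ℤ) :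
    (∀ i, |Fin.append x y i - Fin.append x' y' i| ≤ c) ↔
      (∀ i, |x i - x' i| ≤ c) ∧ ∀ i, |y i - y' i| ≤ c := by
  simp only [Fin.forall_fin_add, Fin.append_left, Fin.append_right]

/-- For any nonempty `X₁ ⊆ ℤ^{n₁}` with the `2n₁`-adjacency (`k(1,n₁)`) and nonempty
`X₂ ⊆ ℤ^{n₂}` with the `2n₂`-adjacency (`k(1,n₂)`), the `k(1,n₁+n₂)`-adjacency
(`2(n₁+n₂)`-adjacency) on `X₁ × X₂ ⊆ ℤ^{n₁+n₂}` is a C-compatible `k`-adjacency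
derived from `(X₁,2n₁)` and `(X₂,2n₂)`. -/
theorem cCompatible_of_cityblock (n₁ n₂ : ℕ) (hn₁ : 1 ≤ n₁) (hn₂ : 1 ≤ n₂)
    (X₁ : Set (Fin n₁ → ℤ)) (X₂ : Set (Fin n₂ → ℤ))
    (hX₁ : X₁.Nonempty) (hX₂ : X₂.Nonempty) :
    ∀ x₁ ∈ X₁, ∀ x₂ ∈ X₂, ∀ x₁' ∈ X₁, ∀ x₂' ∈ X₂,
      (kAdj 1 (Fin.append x₁ x₂) (Fin.append x₁' x₂') ↔
        ((x₂ = x₂' ∧ kAdj 1 x₁ x₁') ∨ (x₁ = x₁' ∧ kAdj 1 x₂ x₂'))) := by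
  intro x₁ _ x₂ _ x₁' _ x₂' _
  rw [kAdj_iff_hammingDist, kAdj_iff_hammingDist, kAdj_iff_hammingDist, hammingDist_append,
    forall_abs_append_sub_le_iff, ← hammingDist_eq_zero (x := x₁),
    ← hammingDist_eq_zero (x := x₂)]
  have h_eq₁ : hammingDist x₁ x₁' = 0 → ∀ i, |x₁ i - x₁' i| ≤ 1 := by
    intro h i
    simp [hammingDist_eq_zero.mp h]
  have h_eq₂ : hammingDist x₂ x₂' = 0 → ∀ i, |x₂ i - x₂' i| ≤ 1 := by
    intro h i
    simp [hammingDist_eq_zero.mp h]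
  constructor
  · rintro ⟨hpos, ⟨h₁, h₂⟩, hle⟩
    by_cases h : hammingDist x₂ x₂' = 0
    · exact Or.inl ⟨h, by omega, h₁, by omega⟩
    · exact Or.inr ⟨by omega, by omega, h₂, by omega⟩
  · rintro (⟨h, hpos, h₁, hle⟩ | ⟨h, hpos, h₂, hle⟩)
    · exact ⟨by omega, ⟨h₁, h_eq₂ h⟩, by omega⟩
    · exact ⟨by omega, ⟨h_eq₁ h, h₂⟩, by omega⟩
end

section
/- Let S = {s₀=(0,0), s₁=(1,−1), s₂=(2,0), s₃=(1,1)} ⊆ ℤ² with the 8-adjacency (k(2,2)-adjacency), and identify S × S with a subset of ℤ⁴. Then the k(4,4)-adjacency (the 80-adjacency) on S × S is a normal k-adjacency derived from (S,8) and (S,8), i.e., an AP₂(8,8)-adjacency on S × S. -/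
/-- `SC₈^{2,4} = {(0,0),(1,-1),(2,0),(1,1)} ⊆ ℤ²`. -/
def SC84 : Set (Fin 2 → ℤ) := {![0, 0], ![1, -1], ![2, 0], ![1, 1]}

theorem kAdj_iff_of_card_le {ι : Type*} [Fintype ι] {t : ℕ} (ht : Fintype.card ι ≤ t)
    (p q : ι → ℤ) : kAdj t p q ↔ p ≠ q ∧ ∀ i, |p i - q i| ≤ 1 :=
  ⟨fun h => ⟨h.1, h.2.1⟩, fun h => ⟨h.1, h.2, (Finset.card_le_univ _).trans ht⟩⟩

/-- If all the adjacencies are the maximal ones, the adjacency on the product is normal. -/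
theorem isNormalAdj_of_le {n₁ n₂ t₁ t₂ t : ℕ} (X : Set (Fin n₁ → ℤ)) (Y : Set (Fin n₂ → ℤ))
    (h₁ : n₁ ≤ t₁) (h₂ : n₂ ≤ t₂) (h : n₁ + n₂ ≤ t) : IsNormalAdj X Y t₁ t₂ t := by
  intro x _ y _ x' _ y' _
  have append_eq_iff : Fin.append x y = Fin.append x' y' ↔ x = x' ∧ y = y' := by
    simp [funext_iff, Fin.forall_fin_add]
  have abs_sub_le_of_eq {n : ℕ} {p q : Fin n → ℤ} (hpq : p = q) : ∀ i, |p i - q i| ≤ 1 := by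
    simp [hpq]
  rw [kAdj_iff_of_card_le (by simpa using h), kAdj_iff_of_card_le (by simpa using h₁),
    kAdj_iff_of_card_le (by simpa using h₂), Ne, append_eq_iff, Fin.forall_fin_add]
  simp only [Fin.append_left, Fin.append_right]
  have hx := @abs_sub_le_of_eq _ x x'
  have hy := @abs_sub_le_of_eq _ y y'
  tauto

/-- The `k(4,4)`-adjacency (the 80-adjacency) on `SC₈^{2,4} × SC₈^{2,4} ⊆ ℤ⁴` is a
normal `k`-adjacency, i.e. an `AP₂(8,8)`-adjacency, derived from `(SC₈^{2,4},8)`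
and `(SC₈^{2,4},8)`. -/
theorem sc84_prod_normal : IsNormalAdj SC84 SC84 2 2 4 := by
  exact isNormalAdj_of_le _ _ le_rfl le_rfl le_rfl
end

section
/- Let X = {x₀=(0,0,0), x₁=(1,0,1), x₂=(2,1,1), x₃=(1,2,1), x₄=(0,2,0), x₅=(−1,1,0)} ⊆ ℤ³ with the 18-adjacency (k(2,3)-adjacency), and identify X × X with a subset of ℤ⁶. Then for t ∈ {2,3}, the k(t,6)-adjacency on X × X is an AP₁(18,18)-adjacency (C-compatible adjacency) derived from (X,18) and (X,18), and for t ∈ {4,5,6}, the k(t,6)-adjacency on X × X is an AP₂(18,18)-adjacency (normal adjacency) derived from (X,18) and (X,18); in particular AP₁*(18,18) = k(2,6) and AP₂*(18,18) = k(4,6). -/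
/-- `AP₁(k₁,k₂)`-adjacency (C-compatible adjacency) on `X × Y`. -/
def IsAP1Adj {n₁ n₂ : ℕ} (X : Set (Fin n₁ → ℤ)) (Y : Set (Fin n₂ → ℤ))
    (t₁ t₂ t : ℕ) : Prop :=
  ∀ x ∈ X, ∀ y ∈ Y, ∀ x' ∈ X, ∀ y' ∈ Y,
    (kAdj t (Fin.append x y) (Fin.append x' y') ↔
      ((y = y' ∧ kAdj t₁ x x') ∨ (x = x' ∧ kAdj t₂ y y')))

/-- `AP₂(k₁,k₂)`-adjacency (normal adjacency) on `X × Y`. -/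
def IsAP2Adj {n₁ n₂ : ℕ} (X : Set (Fin n₁ → ℤ)) (Y : Set (Fin n₂ → ℤ))
    (t₁ t₂ t : ℕ) : Prop :=
  ∀ x ∈ X, ∀ y ∈ Y, ∀ x' ∈ X, ∀ y' ∈ Y,
    (kAdj t (Fin.append x y) (Fin.append x' y') ↔
      ((y = y' ∧ kAdj t₁ x x') ∨ (x = x' ∧ kAdj t₂ y y') ∨
        (kAdj t₁ x x' ∧ kAdj t₂ y y')))

/-- `X = {(0,0,0),(1,0,1),(2,1,1),(1,2,1),(0,2,0),(-1,1,0)} ⊆ ℤ³`, a kind of `SC₁₈^{3,6}`. -/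
def X18 : Set (Fin 3 → ℤ) :=
  {![0, 0, 0], ![1, 0, 1], ![2, 1, 1], ![1, 2, 1], ![0, 2, 0], ![-1, 1, 0]}

/-- The number of coordinates in which two integer points differ. -/
def numDiff {ι : Type*} [Fintype ι] (p q : ι → ℤ) : ℕ :=
  (Finset.univ.filter (fun i => p i ≠ q i)).card

theorem numDiff_eq_zero {ι : Type*} [Fintype ι] {p q : ι → ℤ} : numDiff p q = 0 ↔ p = q := by
  simp [numDiff, Finset.filter_eq_empty_iff, funext_iff]

theorem kAdj_iff {ι : Type*} [Fintype ι] {t : ℕ} {p q : ι → ℤ} :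
    kAdj t p q ↔ numDiff p q ≠ 0 ∧ (∀ i, |p i - q i| ≤ 1) ∧ numDiff p q ≤ t := by
  rw [Ne, numDiff_eq_zero]
  rfl

theorem numDiff_append {m n : ℕ} (x x' : Fin m → ℤ) (y y' : Fin n → ℤ) :
    numDiff (Fin.append x y) (Fin.append x' y') = numDiff x x' + numDiff y y' := by
  simp only [numDiff, Finset.card_filter, Fin.sum_univ_add, Fin.append_left, Fin.append_right]

/-- Adjacency on a product: the numbers of differing coordinates add up. -/
theorem kAdj_append_iff {m n t : ℕ} {x x' : Fin m → ℤ} {y y' : Fin n → ℤ} :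
    kAdj t (Fin.append x y) (Fin.append x' y') ↔
      numDiff x x' + numDiff y y' ≠ 0 ∧
        ((∀ i, |x i - x' i| ≤ 1) ∧ ∀ i, |y i - y' i| ≤ 1) ∧
        numDiff x x' + numDiff y y' ≤ t := by
  rw [kAdj_iff, numDiff_append, Fin.forall_fin_add]
  simp only [Fin.append_left, Fin.append_right]

theorem forall_abs_sub_le_one_of_numDiff_eq_zero {ι : Type*} [Fintype ι] {p q : ι → ℤ}
    (h : numDiff p q = 0) (i : ι) : |p i - q i| ≤ 1 := by
  simp [numDiff_eq_zero.mp h]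

/-- Points of `X18` within sup-distance one are equal or differ in exactly two coordinates. -/
theorem numDiff_of_mem_X18 {x x' : Fin 3 → ℤ} (hx : x ∈ X18) (hx' : x' ∈ X18)
    (h : ∀ i, |x i - x' i| ≤ 1) : numDiff x x' = 0 ∨ numDiff x x' = 2 := by
  simp only [X18, Set.mem_insert_iff, Set.mem_singleton_iff] at hx hx'
  rcases hx with rfl | rfl | rfl | rfl | rfl | rfl <;>
    rcases hx' with rfl | rfl | rfl | rfl | rfl | rfl <;>
    revert h <;> unfold numDiff <;> decide

theorem isAP1Adj_X18 {t : ℕ} (h₂ : 2 ≤ t) (h₃ : t ≤ 3) : IsAP1Adj X18 X18 2 2 t := by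
  intro x hx y hy x' hx' y' hy'
  have hX := numDiff_of_mem_X18 hx hx'
  have hY := numDiff_of_mem_X18 hy hy'
  have hX₀ := forall_abs_sub_le_one_of_numDiff_eq_zero (p := x) (q := x')
  have hY₀ := forall_abs_sub_le_one_of_numDiff_eq_zero (p := y) (q := y')
  rw [kAdj_append_iff, kAdj_iff, kAdj_iff, ← numDiff_eq_zero, ← numDiff_eq_zero]
  generalize (∀ i, |x i - x' i| ≤ 1) = P at *
  generalize (∀ i, |y i - y' i| ≤ 1) = Q at *
  grind

theorem isAP2Adj_X18 {t : ℕ} (h₄ : 4 ≤ t) : IsAP2Adj X18 X18 2 2 t := by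
  intro x hx y hy x' hx' y' hy'
  have hX := numDiff_of_mem_X18 hx hx'
  have hY := numDiff_of_mem_X18 hy hy'
  have hX₀ := forall_abs_sub_le_one_of_numDiff_eq_zero (p := x) (q := x')
  have hY₀ := forall_abs_sub_le_one_of_numDiff_eq_zero (p := y) (q := y')
  rw [kAdj_append_iff, kAdj_iff, kAdj_iff, ← numDiff_eq_zero, ← numDiff_eq_zero]
  generalize (∀ i, |x i - x' i| ≤ 1) = P at *
  generalize (∀ i, |y i - y' i| ≤ 1) = Q at *
  grind

theorem kAdj_X18_edge : kAdj 2 (![0, 0, 0] : Fin 3 → ℤ) ![1, 0, 1] := by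
  unfold kAdj
  decide

theorem numDiff_X18_edge : numDiff (![0, 0, 0] : Fin 3 → ℤ) ![1, 0, 1] = 2 := by
  unfold numDiff
  decide

theorem two_le_of_isAP1Adj_X18 {t : ℕ} (h : IsAP1Adj X18 X18 2 2 t) : 2 ≤ t := by
  have hadj := (h ![0, 0, 0] (by simp [X18]) ![0, 0, 0] (by simp [X18])
    ![1, 0, 1] (by simp [X18]) ![0, 0, 0] (by simp [X18])).mpr (Or.inl ⟨rfl, kAdj_X18_edge⟩)
  have hle := (kAdj_append_iff.mp hadj).2.2
  rw [numDiff_X18_edge] at hle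
  omega

theorem four_le_of_isAP2Adj_X18 {t : ℕ} (h : IsAP2Adj X18 X18 2 2 t) : 4 ≤ t := by
  have hadj := (h ![0, 0, 0] (by simp [X18]) ![0, 0, 0] (by simp [X18])
    ![1, 0, 1] (by simp [X18]) ![1, 0, 1] (by simp [X18])).mpr
      (Or.inr (Or.inr ⟨kAdj_X18_edge, kAdj_X18_edge⟩))
  have hle := (kAdj_append_iff.mp hadj).2.2
  rw [numDiff_X18_edge] at hle
  omega

/-- For `t ∈ {2,3}`, `k(t,6)` is an `AP₁(18,18)`-adjacency on `X × X ⊆ ℤ⁶`; for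
`t ∈ {4,5,6}`, `k(t,6)` is an `AP₂(18,18)`-adjacency on `X × X`; in particular
`AP₁*(18,18) = k(2,6)` and `AP₂*(18,18) = k(4,6)`. -/
theorem x18_prod_AP_adjacencies :
    (∀ t : ℕ, (t = 2 ∨ t = 3) → IsAP1Adj X18 X18 2 2 t) ∧
    (∀ t : ℕ, (t = 4 ∨ t = 5 ∨ t = 6) → IsAP2Adj X18 X18 2 2 t) ∧
    IsLeast {t : ℕ | IsAP1Adj X18 X18 2 2 t} 2 ∧
    IsLeast {t : ℕ | IsAP2Adj X18 X18 2 2 t} 4 := by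
  refine ⟨fun t ht => isAP1Adj_X18 (by omega) (by omega), fun t ht => isAP2Adj_X18 (by omega),
    ⟨isAP1Adj_X18 le_rfl (by omega), fun t ht => two_le_of_isAP1Adj_X18 ht⟩,
    ⟨isAP2Adj_X18 le_rfl, fun t ht => four_le_of_isAP2Adj_X18 ht⟩⟩
end

section
/- Let A = {(0,0),(1,0),(1,1),(0,1)} ⊆ ℤ² with the 4-adjacency (k(1,2)-adjacency) (a simple closed 4-curve SC₄^{2,4}) and B = {(0,0),(1,−1),(2,0),(1,1)} ⊆ ℤ² with the 8-adjacency (k(2,2)-adjacency) (a simple closed 8-curve SC₈^{2,4}). Identify (A×B) × (A×B) with a subset of ℤ⁸. Then for no t with 1 ≤ t ≤ 8 is the k(t,8)-adjacency on (A×B)×(A×B) an AP₁(4,8,4,8)-adjacency, i.e., there is no t such that for all p = (a,b,a′,b′) and q = (c,d,c′,d′) in (A×B)×(A×B), p and q are k(t,8)-adjacent if and only if exactly one of the four factor pairs (a,c), (b,d), (a′,c′), (b′,d′) is adjacent in its respective adjacency (4, 8, 4, 8) while the other three factors are equal. Consequently, the product of the two AP₁*-groups SC₄^{2,4} and SC₈^{2,4}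 is not an AP₁*-group, so the AP₁*-k-group (and AP₁-k-group) does not have the product property. -/
/-- `SC₄^{2,4} = {(0,0),(1,0),(1,1),(0,1)} ⊆ ℤ²` with the 4-adjacency. -/
def A4 : Set (Fin 2 → ℤ) := {![0, 0], ![1, 0], ![1, 1], ![0, 1]}

/-- `SC₈^{2,4} = {(0,0),(1,-1),(2,0),(1,1)} ⊆ ℤ²` with the 8-adjacency. -/
def B8 : Set (Fin 2 → ℤ) := {![0, 0], ![1, -1], ![2, 0], ![1, 1]}

/-- Concatenation of a quadruple of points of `ℤ²` into a point of `ℤ⁸`. -/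
def quad (a b a' b' : Fin 2 → ℤ) : Fin (2 + 2 + (2 + 2)) → ℤ :=
  Fin.append (Fin.append a b) (Fin.append a' b')

/-- For no `t` with `1 ≤ t ≤ 8` is the `k(t,8)`-adjacency on
`(SC₄^{2,4} × SC₈^{2,4}) × (SC₄^{2,4} × SC₈^{2,4}) ⊆ ℤ⁸` an
`AP₁(4,8,4,8)`-adjacency, i.e. no `k(t,8)`-adjacency holds between two points of the
product exactly when one of the four factor pairs is adjacent (in the `4,8,4,8`
adjacencies respectively) and the other three factors are equal.  Consequently the
product of the `AP₁*`-groups `SC₄^{2,4}` and `SC₈^{2,4}` is not an `AP₁*`-group: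
the `AP₁*`-`k`-group (and the `AP₁`-`k`-group) does not have the product property. -/
theorem no_AP1_adjacency_on_product :
    ∀ t : ℕ, 1 ≤ t → t ≤ 8 →
      ¬ (∀ a ∈ A4, ∀ b ∈ B8, ∀ a' ∈ A4, ∀ b' ∈ B8,
          ∀ c ∈ A4, ∀ d ∈ B8, ∀ c' ∈ A4, ∀ d' ∈ B8,
          (kAdj t (quad a b a' b') (quad c d c' d') ↔
            ((kAdj 1 a c ∧ b = d ∧ a' = c' ∧ b' = d') ∨
              (a = c ∧ kAdj 2 b d ∧ a' = c' ∧ b' = d') ∨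
              (a = c ∧ b = d ∧ kAdj 1 a' c' ∧ b' = d') ∨
              (a = c ∧ b = d ∧ a' = c' ∧ kAdj 2 b' d')))) := by
  intro t ht _ h
  rcases ht.eq_or_lt with rfl | ht
  · -- A diagonal step in one 8-adjacent factor changes two coordinates.
    have key := (h ![0, 0] (by simp [A4]) ![0, 0] (by simp [B8]) ![0, 0] (by simp [A4])
      ![0, 0] (by simp [B8]) ![0, 0] (by simp [A4]) ![1, -1] (by simp [B8])
      ![0, 0] (by simp [A4]) ![0, 0] (by simp [B8])).2
      (Or.inr (Or.inl ⟨rfl, by unfold kAdj; decide, rfl, rfl⟩))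
    exact absurd key.2.2 (by decide)
  · -- Unit steps in both 4-adjacent factors change two coordinates.
    have key := (h ![0, 0] (by simp [A4]) ![0, 0] (by simp [B8]) ![0, 0] (by simp [A4])
      ![0, 0] (by simp [B8]) ![1, 0] (by simp [A4]) ![0, 0] (by simp [B8])
      ![1, 0] (by simp [A4]) ![0, 0] (by simp [B8])).1
      ⟨by decide, by decide, le_trans (by decide) (Nat.succ_le_of_lt ht)⟩
    simp at key
end
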